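/- arXiv:2402.04779 — 5 statements merged into one kernel-verified Lean document; each statement's English description precedes it below -/
import Mathlib

section
/- Let X_1,…,X_N be jointly distributed random variables with values in a finite type V, let n < N, let W be a finite type and let f : V^n → W be a function that is contextual for position n, i.e. for any two prefixes x, x' ∈ V^n each having positive probability, f(x) = f(x') implies that the conditional distributions of X_{n+1} given X_{≤n} = x and given X_{≤n} = x' are equal. Then H(X_{n+1} | f(X_1,…,X_n)) = H(X_{n+1} | (X_1,…,X_n)). -/
open Finset

/-- Shannon entropy of a pmf `q` on a finite type, `H(q) = -∑ s, q s * log (q s)`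
(with the convention `0 * log 0 = 0`, which holds since `Real.log 0 = 0`). -/
noncomputable def shannonEntropy {S : Type*} [Fintype S] (q : S → ℝ) : ℝ :=
  -∑ s, q s * Real.log (q s)

/-- Marginal probability `P(X = a)` for a random variable `X` on a finite sample
space with joint pmf `p`. -/
noncomputable def probOf {Ω A : Type*} [Fintype Ω] [DecidableEq A]
    (p : Ω → ℝ) (X : Ω → A) (a : A) : ℝ :=
  ∑ ω, if X ω = a then p ω else 0

/-- Conditional pmf of `Y` given `X = a`: `b ↦ P(X = a, Y = b) / P(X = a)`. -/
noncomputable def condDist {Ω A B : Type*} [Fintype Ω] [DecidableEq A] [DecidableEq B]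
    (p : Ω → ℝ) (X : Ω → A) (Y : Ω → B) (a : A) : B → ℝ :=
  fun b => (∑ ω, if X ω = a ∧ Y ω = b then p ω else 0) / probOf p X a

/-- Conditional entropy `H(Y | X) = ∑_{a : P(X=a) > 0} P(X = a) · H(Y | X = a)`.
(Terms with `P(X = a) = 0` contribute `0` to the sum, so we may sum over all `a`.) -/
noncomputable def condEnt {Ω A B : Type*} [Fintype Ω] [Fintype A] [Fintype B]
    [DecidableEq A] [DecidableEq B] (p : Ω → ℝ) (X : Ω → A) (Y : Ω → B) : ℝ :=
  ∑ a, probOf p X a * shannonEntropy (condDist p X Y a)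

/-- Mutual information `I(X;Y) = H(Y) - H(Y|X)`. -/
noncomputable def mutInfo {Ω A B : Type*} [Fintype Ω] [Fintype A] [Fintype B]
    [DecidableEq A] [DecidableEq B] (p : Ω → ℝ) (X : Ω → A) (Y : Ω → B) : ℝ :=
  shannonEntropy (fun b => probOf p Y b) - condEnt p X Y

/-- The prefix `X_{≤i} = (X_1, …, X_i)` of the process `X_1, …, X_N`
(0-based: `X_k` is coordinate `k - 1`). -/
def prefixVar {N : ℕ} {V : Type*} (i : ℕ) (h : i ≤ N) : (Fin N → V) → Fin i → V :=
  fun ω k => ω (Fin.castLE h k)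

section FiniteProbability

variable {Ω A B C : Type*} [Fintype Ω] [DecidableEq A] [DecidableEq B] [DecidableEq C]

theorem probOf_nonneg {p : Ω → ℝ} (hp : ∀ ω, 0 ≤ p ω) (X : Ω → A) (a : A) :
    0 ≤ probOf p X a :=
  Finset.sum_nonneg fun ω _ => by split_ifs <;> simp [hp ω]

theorem probOf_mono {p q : Ω → ℝ} (hpq : ∀ ω, p ω ≤ q ω) (X : Ω → A) (a : A) :
    probOf p X a ≤ probOf q X a :=
  Finset.sum_le_sum fun ω _ => by split_ifs <;> simp [hpq ω]

/-- The law of `f ∘ X` is the pushforward of the law of `X` under `f`. -/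
theorem probOf_comp [Fintype A] (p : Ω → ℝ) (X : Ω → A) (f : A → C) (c : C) :
    probOf p (fun ω => f (X ω)) c = ∑ a, if f a = c then probOf p X a else 0 := by
  simp only [probOf, ← Finset.sum_filter (fun a => f a = c)]
  rw [Finset.sum_comm]
  refine Finset.sum_congr rfl fun ω _ => ?_
  rw [Finset.sum_ite_eq]
  simp

/-- The conditional pmf in terms of the law of `X` under `p` restricted to `Y = b`. -/
theorem condDist_apply (p : Ω → ℝ) (X : Ω → A) (Y : Ω → B) (a : A) (b : B) :
    condDist p X Y a b
      = probOf (fun ω => if Y ω = b then p ω else 0) X a / probOf p X a := by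
  simp only [condDist, probOf, ite_and]

theorem probOf_mul_condDist {p : Ω → ℝ} (hp : ∀ ω, 0 ≤ p ω) (X : Ω → A) (Y : Ω → B)
    (a : A) (b : B) :
    probOf p X a * condDist p X Y a b
      = probOf (fun ω => if Y ω = b then p ω else 0) X a := by
  rw [condDist_apply]
  refine mul_div_cancel_of_imp' fun h => le_antisymm ?_ ?_
  · exact (probOf_mono (fun ω => by split_ifs <;> simp [hp ω]) X a).trans_eq h
  · exact probOf_nonneg (fun ω => by split_ifs <;> simp [hp ω]) X a

/-- If the conditional pmf of `Y` given `X = a` depends only on `f a`, then it is also the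
conditional pmf of `Y` given `f ∘ X = f a`. -/
theorem condDist_comp [Fintype A] {p : Ω → ℝ} (hp : ∀ ω, 0 ≤ p ω) (X : Ω → A) (Y : Ω → B)
    (f : A → C)
    (hf : ∀ a a', 0 < probOf p X a → 0 < probOf p X a' → f a = f a' →
      condDist p X Y a = condDist p X Y a')
    {a : A} (ha : 0 < probOf p X a) :
    condDist p (fun ω => f (X ω)) Y (f a) = condDist p X Y a := by
  have hpos : 0 < probOf p (fun ω => f (X ω)) (f a) := by
    rw [probOf_comp]
    refine Finset.sum_pos' (fun a' _ => ?_) ⟨a, Finset.mem_univ a, by simpa using ha⟩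
    split_ifs
    exacts [probOf_nonneg hp X a', le_rfl]
  funext b
  rw [condDist_apply, div_eq_iff hpos.ne', probOf_comp, probOf_comp, Finset.mul_sum]
  refine Finset.sum_congr rfl fun a' _ => ?_
  split_ifs with h
  · rw [← probOf_mul_condDist hp, mul_comm]
    rcases (probOf_nonneg hp X a').eq_or_lt with h0 | h0
    · simp [← h0]
    · rw [hf a' a h0 ha h]
  · simp

/-- If the conditional pmf of `Y` given `X = a` depends only on `f a`, then conditioning `Y`
on `f ∘ X` yields the same entropy as conditioning on `X`. -/
theorem condEnt_comp_eq [Fintype A] [Fintype B] [Fintype C] {p : Ω → ℝ} (hp : ∀ ω, 0 ≤ p ω)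
    (X : Ω → A) (Y : Ω → B) (f : A → C)
    (hf : ∀ a a', 0 < probOf p X a → 0 < probOf p X a' → f a = f a' →
      condDist p X Y a = condDist p X Y a') :
    condEnt p (fun ω => f (X ω)) Y = condEnt p X Y := by
  simp only [condEnt, probOf_comp p X f, Finset.sum_mul]
  rw [Finset.sum_comm]
  refine Finset.sum_congr rfl fun a _ => ?_
  simp only [ite_mul, zero_mul, Finset.sum_ite_eq, Finset.mem_univ, if_true]
  rcases (probOf_nonneg hp X a).eq_or_lt with h0 | h0
  · simp [← h0]
  · rw [condDist_comp hp X Y f hf h0]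

end FiniteProbability

/-- If `f` is contextual for position `n` (equal `f`-values on two
positive-probability prefixes force equal conditional next-token distributions), then
`H(X_{n+1} | f(X_1,…,X_n)) = H(X_{n+1} | (X_1,…,X_n))`. -/
theorem contextual_condEnt_eq {N : ℕ} {V W : Type*} [Fintype V] [DecidableEq V]
    [Fintype W] [DecidableEq W]
    (p : (Fin N → V) → ℝ) (hp0 : ∀ x, 0 ≤ p x) (hp1 : ∑ x, p x = 1)
    (n : ℕ) (hn : n < N)
    (f : (Fin n → V) → W)
    (hf : ∀ x x' : Fin n → V,
      0 < probOf p (prefixVar n hn.le) x →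
      0 < probOf p (prefixVar n hn.le) x' →
      f x = f x' →
      condDist p (prefixVar n hn.le) (fun ω => ω ⟨n, hn⟩) x
        = condDist p (prefixVar n hn.le) (fun ω => ω ⟨n, hn⟩) x') :
    condEnt p (fun ω => f (prefixVar n hn.le ω)) (fun ω => ω ⟨n, hn⟩)
      = condEnt p (prefixVar n hn.le) (fun ω => ω ⟨n, hn⟩) := by
  exact condEnt_comp_eq hp0 _ _ f hf
end

section
/- Let V ≥ 1 and consider the softCopyLast process X_1, X_2, … with values in Fin V: X_1 is uniform on Fin V, and for each n ≥ 1, conditionally on (X_1,…,X_n) = (x_1,…,x_n), the next token satisfies P(X_{n+1} = y) = (1 − e^{−n})·1[y = x_n] + e^{−n}/V. Then for every n ≥ 1, every nonempty index set Λ ⊆ {1,…,n}, and every assignment x_Λ of values with positive probability, the pointwise conditional entropy H(X_{n+1} | X_Λ = x_Λ) does not depend on the values x_Λ, and moreover depends on Λ only through its largest element: if Λ, Λ' ⊆ {1,…,n} are nonempty with max Λ = max Λ', then H(X_{n+1} | X_Λ = x_Λ) = H(X_{n+1} | X_{Λ'} = x'_{Λ'}) for all positive-probability assignments. In particular, the softCopyLast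 distribution is causally isotropic. -/
open Finset

/-- A joint pmf of `X_1, …, X_N` is *causally isotropic* if for every `n < N`,
every index set `Λ ⊆ {1,…,n}` and any two positive-probability assignments
`xs, xs'` of values to the coordinates in `Λ`, the pointwise conditional entropies
`H(X_{n+1} | X_Λ = xs)` and `H(X_{n+1} | X_Λ = xs')` coincide. -/
def CausallyIsotropic {N : ℕ} {V : Type*} [Fintype V] [DecidableEq V]
    (p : (Fin N → V) → ℝ) : Prop :=
  ∀ (n : ℕ) (hn : n < N) (Λ : Finset (Fin N)), (∀ j ∈ Λ, (j : ℕ) < n) →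
    ∀ xs xs' : {j // j ∈ Λ} → V,
      0 < probOf p (fun ω (j : {j // j ∈ Λ}) => ω j.1) xs →
      0 < probOf p (fun ω (j : {j // j ∈ Λ}) => ω j.1) xs' →
      shannonEntropy
          (condDist p (fun ω (j : {j // j ∈ Λ}) => ω j.1) (fun ω => ω ⟨n, hn⟩) xs)
        = shannonEntropy
          (condDist p (fun ω (j : {j // j ∈ Λ}) => ω j.1) (fun ω => ω ⟨n, hn⟩) xs')

/-- The joint pmf of the `softCopyLast` process `X_1, …, X_N` on `Fin V`
(`X_k` is coordinate `k - 1`): `X_1` is uniform on `Fin V`, and conditionally on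
`(X_1,…,X_n)`, `P(X_{n+1} = y) = (1 - e^{-n})·1[y = X_n] + e^{-n}/V`. -/
noncomputable def softCopyLast (N V : ℕ) : (Fin N → Fin V) → ℝ := fun x =>
  (V : ℝ)⁻¹ *
    ∏ m : Fin N,
      if _h : 0 < (m : ℕ) then
        (1 - Real.exp (-((m : ℕ) : ℝ)))
            * (if x m = x ⟨(m : ℕ) - 1, lt_of_le_of_lt (Nat.sub_le _ _) m.2⟩ then 1 else 0)
          + Real.exp (-((m : ℕ) : ℝ)) / V
      else 1

/-- The transition factor of the `softCopyLast` process at coordinate `m`. -/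
noncomputable def softCopyFactor {N V : ℕ} (m : Fin N) (x : Fin N → Fin V) : ℝ :=
  if _h : 0 < (m : ℕ) then
    (1 - Real.exp (-((m : ℕ) : ℝ)))
        * (if x m = x ⟨(m : ℕ) - 1, lt_of_le_of_lt (Nat.sub_le _ _) m.2⟩ then 1 else 0)
      + Real.exp (-((m : ℕ) : ℝ)) / V
  else 1

/-- The product of the transition factors at the coordinates below `k`. -/
noncomputable def softCopyPartialProd {N V : ℕ} (k : ℕ) (x : Fin N → Fin V) : ℝ :=
  ∏ m ∈ (univ.filter fun i : Fin N => (i : ℕ) < k), softCopyFactor m x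

theorem softCopyLast_eq_inv_mul {N V : ℕ} (x : Fin N → Fin V) :
    softCopyLast N V x = (V : ℝ)⁻¹ * softCopyPartialProd N x := by
  simp [softCopyLast, softCopyPartialProd, softCopyFactor]

theorem softCopyFactor_update {N V : ℕ} {m j : Fin N} (h : m < j) (x : Fin N → Fin V)
    (z : Fin V) : softCopyFactor m (Function.update x j z) = softCopyFactor m x := by
  have h' : (m : ℕ) < j := h
  have h1 : m ≠ j := h.ne
  have h2 : (⟨(m : ℕ) - 1, lt_of_le_of_lt (Nat.sub_le _ _) m.2⟩ : Fin N) ≠ j := by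
    intro e
    have := congrArg Fin.val e
    simp only at this
    omega
  simp [softCopyFactor, Function.update_of_ne h1, Function.update_of_ne h2]

theorem softCopyPartialProd_update {N V : ℕ} {k : ℕ} {j : Fin N} (h : k ≤ j) (x : Fin N → Fin V)
    (z : Fin V) : softCopyPartialProd k (Function.update x j z) = softCopyPartialProd k x := by
  refine prod_congr rfl fun m hm => softCopyFactor_update ?_ x z
  exact Fin.lt_def.2 (lt_of_lt_of_le (mem_filter.1 hm).2 h)

theorem softCopyPartialProd_succ {N V : ℕ} (m : Fin N) (x : Fin N → Fin V) :
    softCopyPartialProd (m + 1) x = softCopyPartialProd m x * softCopyFactor m x := by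
  have : (univ.filter fun i : Fin N => (i : ℕ) < m + 1)
      = insert m (univ.filter fun i : Fin N => (i : ℕ) < m) := by
    ext i
    simp only [mem_filter, mem_univ, true_and, mem_insert, Fin.ext_iff]
    omega
  rw [softCopyPartialProd, this, prod_insert (by simp), mul_comm, softCopyPartialProd]

/-- Integrating a function of the new token against the transition factor. -/
theorem sum_softCopyFactor_update_mul {N V : ℕ} {m : Fin N} (hm : 0 < (m : ℕ))
    (x : Fin N → Fin V) (h : Fin V → ℝ) :
    ∑ z, softCopyFactor m (Function.update x m z) * h z
      = (1 - Real.exp (-((m : ℕ) : ℝ)))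
          * h (x ⟨(m : ℕ) - 1, lt_of_le_of_lt (Nat.sub_le _ _) m.2⟩)
        + Real.exp (-((m : ℕ) : ℝ)) / V * ∑ z, h z := by
  have h2 : (⟨(m : ℕ) - 1, lt_of_le_of_lt (Nat.sub_le _ _) m.2⟩ : Fin N) ≠ m := by
    intro e
    have := congrArg Fin.val e
    simp only at this
    omega
  simp [softCopyFactor, hm, Function.update_of_ne h2, add_mul, sum_add_distrib, mul_sum]

/-- Resampling one coordinate multiplies the total sum by the number of values. -/
theorem sum_sum_update {ι S : Type*} [Fintype ι] [DecidableEq ι] [Fintype S]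
    (i : ι) (F : (ι → S) → ℝ) :
    ∑ x, ∑ z, F (Function.update x i z) = Fintype.card S * ∑ x, F x := by
  calc ∑ x, ∑ z, F (Function.update x i z)
      = ∑ a : (ι → S) × S, F (Function.update a.1 i a.2) :=
        (Fintype.sum_prod_type fun a : (ι → S) × S => F (Function.update a.1 i a.2)).symm
    _ = ∑ a : (ι → S) × S, F a.1 := by
      refine sum_nbij' (fun a => (Function.update a.1 i a.2, a.1 i))
        (fun a => (Function.update a.1 i a.2, a.1 i)) ?_ ?_ ?_ ?_ ?_ <;> simp
    _ = Fintype.card S * ∑ x, F x := by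
      simp [Fintype.sum_prod_type, mul_sum]

theorem sum_softCopyPartialProd_succ_mul {N V : ℕ} (hV : 1 ≤ V) (m : Fin N)
    (G : (Fin N → Fin V) → ℝ) :
    ∑ x, softCopyPartialProd (m + 1) x * G x
      = (V : ℝ)⁻¹ * ∑ x, softCopyPartialProd m x *
          ∑ z, softCopyFactor m (Function.update x m z) * G (Function.update x m z) := by
  have hV' : (V : ℝ) ≠ 0 := by positivity
  have := sum_sum_update m fun x => softCopyPartialProd (m + 1) x * G x
  rw [Fintype.card_fin] at this
  rw [eq_inv_mul_iff_mul_eq₀ hV', ← this]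
  refine sum_congr rfl fun x _ => ?_
  rw [mul_sum]
  refine sum_congr rfl fun z _ => ?_
  rw [softCopyPartialProd_succ, softCopyPartialProd_update le_rfl, mul_assoc]

/-- A function of the coordinates below `k` that sums to zero against the partial product of
length `k` also does so against every longer one. -/
theorem sum_softCopyPartialProd_mul_eq_zero {N V : ℕ} (hV : 1 ≤ V) {k : ℕ} (hk : 0 < k)
    {G : (Fin N → Fin V) → ℝ}
    (hG : ∀ j : Fin N, k ≤ j → ∀ x z, G (Function.update x j z) = G x)
    (h0 : ∑ x, softCopyPartialProd k x * G x = 0) {l : ℕ} (hkl : k ≤ l) (hl : l ≤ N) :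
    ∑ x, softCopyPartialProd l x * G x = 0 := by
  have hV' : (V : ℝ) ≠ 0 := by positivity
  induction l, hkl using Nat.le_induction with
  | base => exact h0
  | succ l hkl ih =>
    rw [sum_softCopyPartialProd_succ_mul hV (⟨l, hl⟩ : Fin N)]
    have key : ∀ x, ∑ z, softCopyFactor ⟨l, hl⟩ (Function.update x ⟨l, hl⟩ z)
        * G (Function.update x ⟨l, hl⟩ z) = G x := by
      intro x
      rw [sum_congr rfl fun z _ => by rw [hG ⟨l, hl⟩ hkl],
        sum_softCopyFactor_update_mul (m := ⟨l, hl⟩) (by simp; omega) x fun _ => G x]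
      simp
      field_simp
      ring
    simp only [key]
    rw [ih (by omega), mul_zero]

/-- The one-step Markov recursion of the `softCopyLast` process. -/
theorem sum_softCopyLast_mul_ite {N V : ℕ} (hV : 1 ≤ V) {n : Fin N} (hn : 0 < (n : ℕ))
    {φ : (Fin N → Fin V) → ℝ}
    (hφ : ∀ j : Fin N, n ≤ j → ∀ x z, φ (Function.update x j z) = φ x) (y : Fin V) :
    ∑ x, softCopyLast N V x * (φ x * if x n = y then 1 else 0)
      = (1 - Real.exp (-((n : ℕ) : ℝ))) * ∑ x, softCopyLast N V x *
          (φ x * if x ⟨(n : ℕ) - 1, lt_of_le_of_lt (Nat.sub_le _ _) n.2⟩ = y then 1 else 0)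
        + Real.exp (-((n : ℕ) : ℝ)) / V * ∑ x, softCopyLast N V x * φ x := by
  have hV' : (V : ℝ) ≠ 0 := by positivity
  set p : Fin N := ⟨(n : ℕ) - 1, lt_of_le_of_lt (Nat.sub_le _ _) n.2⟩ with hp
  have hpv : (p : ℕ) = n - 1 := rfl
  set a := Real.exp (-((n : ℕ) : ℝ)) with ha
  let G : (Fin N → Fin V) → ℝ := fun x =>
    φ x * ((if x n = y then 1 else 0) - (1 - a) * (if x p = y then 1 else 0) - a / V)
  have hpn : p ≠ n := fun e => by have := congrArg Fin.val e; omega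
  have hG : ∑ x, softCopyPartialProd N x * G x = 0 := by
    refine sum_softCopyPartialProd_mul_eq_zero hV (k := n + 1) (by omega) ?_ ?_ n.2 le_rfl
    · intro j hj x z
      have h1 : n ≠ j := fun e => by have := congrArg Fin.val e; omega
      have h2 : p ≠ j := fun e => by have := congrArg Fin.val e; omega
      simp only [G, hφ j (Fin.le_def.2 (by omega)), Function.update_of_ne h1,
        Function.update_of_ne h2]
    · rw [sum_softCopyPartialProd_succ_mul hV]
      have key : ∀ x, ∑ z, softCopyFactor n (Function.update x n z)
          * G (Function.update x n z) = 0 := by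
        intro x
        simp only [G, hφ n le_rfl, Function.update_self, Function.update_of_ne hpn]
        rw [sum_softCopyFactor_update_mul hn x fun z =>
          φ x * ((if z = y then 1 else 0) - (1 - a) * (if x p = y then 1 else 0) - a / V)]
        rw [← mul_sum]
        simp only [sum_sub_distrib, sum_ite_eq', mem_univ, if_true, sum_const, card_univ,
          Fintype.card_fin, nsmul_eq_mul, ← ha, ← hp]
        field_simp
        ring
      simp [key]
  have hlin : ∑ x, softCopyLast N V x * (φ x * if x n = y then 1 else 0)
      - ((1 - a) * ∑ x, softCopyLast N V x * (φ x * if x p = y then 1 else 0)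
        + a / V * ∑ x, softCopyLast N V x * φ x)
      = (V : ℝ)⁻¹ * ∑ x, softCopyPartialProd N x * G x := by
    simp only [softCopyLast_eq_inv_mul, mul_sum]
    rw [← sum_add_distrib, ← sum_sub_distrib]
    refine sum_congr rfl fun x _ => ?_
    simp only [G]
    ring
  rw [hG, mul_zero] at hlin
  linarith

/-- The probability that token `m` has been copied without interruption up to token `n`. -/
noncomputable def copyProb (m n : ℕ) : ℝ :=
  ∏ k ∈ Ioc m n, (1 - Real.exp (-(k : ℝ)))

/-- If `φ` is supported on `x m = v` and only depends on the coordinates up to `m`, then under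
the weight `φ` a later token is a mixture of the point mass at `v` and the uniform law. -/
theorem sum_softCopyLast_mul_ite_of_support {N V : ℕ} (hV : 1 ≤ V) {m : Fin N} {v : Fin V}
    {φ : (Fin N → Fin V) → ℝ}
    (hφ : ∀ j : Fin N, m < j → ∀ x z, φ (Function.update x j z) = φ x)
    (hsupp : ∀ x, φ x ≠ 0 → x m = v) {n : ℕ} (hmn : (m : ℕ) ≤ n) (hn : n < N) (y : Fin V) :
    ∑ x, softCopyLast N V x * (φ x * if x ⟨n, hn⟩ = y then 1 else 0)
      = (copyProb m n * (if v = y then 1 else 0) + (1 - copyProb m n) / V)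
        * ∑ x, softCopyLast N V x * φ x := by
  induction n, hmn using Nat.le_induction with
  | base =>
    simp only [copyProb, Ioc_self, prod_empty, sub_self, zero_div, add_zero, one_mul, mul_sum]
    refine sum_congr rfl fun x _ => ?_
    by_cases h : φ x = 0
    · simp [h]
    · rw [Fin.eta, hsupp x h]
      ring
  | succ n hmn ih =>
    rw [sum_softCopyLast_mul_ite hV (n := ⟨n + 1, hn⟩) (Nat.succ_pos n)
      (fun j hj => hφ j (Fin.lt_def.2 (by have := Fin.le_def.1 hj; simp only at this; omega)))]
    simp only [Nat.add_sub_cancel]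
    rw [ih (by omega)]
    have : copyProb m (n + 1) = copyProb m n * (1 - Real.exp (-((n + 1 : ℕ) : ℝ))) :=
      prod_Ioc_succ_top hmn _
    rw [this]
    ring

theorem condDist_softCopyLast {N V : ℕ} (hV : 1 ≤ V) {n : ℕ} (hn : n < N)
    {Λ : Finset (Fin N)} (hne : Λ.Nonempty) (hΛ : ∀ j ∈ Λ, (j : ℕ) < n)
    {xs : {j // j ∈ Λ} → Fin V}
    (hxs : 0 < probOf (softCopyLast N V) (fun ω (j : {j // j ∈ Λ}) => ω j.1) xs) (y : Fin V) :
    condDist (softCopyLast N V) (fun ω (j : {j // j ∈ Λ}) => ω j.1) (fun ω => ω ⟨n, hn⟩) xs y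
      = copyProb (Λ.max' hne) n * (if xs ⟨Λ.max' hne, Λ.max'_mem hne⟩ = y then 1 else 0)
        + (1 - copyProb (Λ.max' hne) n) / V := by
  let φ : (Fin N → Fin V) → ℝ := fun x =>
    if (fun j : {j // j ∈ Λ} => x j.1) = xs then 1 else 0
  have hp : probOf (softCopyLast N V) (fun ω (j : {j // j ∈ Λ}) => ω j.1) xs
      = ∑ x, softCopyLast N V x * φ x := by
    simp [probOf, φ]
  have hφ : ∀ j : Fin N, Λ.max' hne < j → ∀ x z, φ (Function.update x j z) = φ x := by
    intro j hj x z
    have : (fun i : {j // j ∈ Λ} => Function.update x j z i.1) = fun i => x i.1 := by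
      funext i
      exact Function.update_of_ne (((Λ.le_max' _ i.2).trans_lt hj).ne) _ _
    simp only [φ, this]
  have hsupp : ∀ x, φ x ≠ 0 → x (Λ.max' hne) = xs ⟨Λ.max' hne, Λ.max'_mem hne⟩ := by
    intro x hx
    by_cases h : (fun j : {j // j ∈ Λ} => x j.1) = xs
    · rw [← h]
    · simp [φ, h] at hx
  have key := sum_softCopyLast_mul_ite_of_support hV hφ hsupp
    (hΛ _ (Λ.max'_mem hne)).le hn y
  rw [condDist, div_eq_iff hxs.ne', hp, ← key]
  refine sum_congr rfl fun x _ => ?_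
  simp only [φ, ite_and, mul_ite, mul_one, mul_zero]
  split_ifs <;> rfl

theorem shannonEntropy_comp_equiv {S T : Type*} [Fintype S] [Fintype T] (e : S ≃ T)
    (q : T → ℝ) : shannonEntropy (fun s => q (e s)) = shannonEntropy q := by
  unfold shannonEntropy
  rw [Equiv.sum_comp e fun t => q t * Real.log (q t)]

/-- The entropy of a perturbed point mass does not depend on the location of the atom. -/
theorem shannonEntropy_point_mixture {S : Type*} [Fintype S] [DecidableEq S] (c d : ℝ)
    (v w : S) :
    shannonEntropy (fun y => c * (if v = y then 1 else 0) + d)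
      = shannonEntropy (fun y => c * (if w = y then 1 else 0) + d) := by
  rw [← shannonEntropy_comp_equiv (Equiv.swap v w)]
  simp [← Equiv.symm_apply_eq, Equiv.swap_apply_left]

theorem shannonEntropy_condDist_softCopyLast {N V : ℕ} (hV : 1 ≤ V) {n : ℕ} (hn : n < N)
    {Λ Λ' : Finset (Fin N)} (hne : Λ.Nonempty) (hne' : Λ'.Nonempty)
    (hΛ : ∀ j ∈ Λ, (j : ℕ) < n) (hΛ' : ∀ j ∈ Λ', (j : ℕ) < n)
    (hmax : Λ.max' hne = Λ'.max' hne')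
    {xs : {j // j ∈ Λ} → Fin V} {xs' : {j // j ∈ Λ'} → Fin V}
    (hxs : 0 < probOf (softCopyLast N V) (fun ω (j : {j // j ∈ Λ}) => ω j.1) xs)
    (hxs' : 0 < probOf (softCopyLast N V) (fun ω (j : {j // j ∈ Λ'}) => ω j.1) xs') :
    shannonEntropy (condDist (softCopyLast N V)
        (fun ω (j : {j // j ∈ Λ}) => ω j.1) (fun ω => ω ⟨n, hn⟩) xs)
      = shannonEntropy (condDist (softCopyLast N V)
          (fun ω (j : {j // j ∈ Λ'}) => ω j.1) (fun ω => ω ⟨n, hn⟩) xs') := by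
  rw [funext (condDist_softCopyLast hV hn hne hΛ hxs),
    funext (condDist_softCopyLast hV hn hne' hΛ' hxs'),
    show copyProb (Λ.max' hne) n = copyProb (Λ'.max' hne') n by rw [hmax]]
  exact shannonEntropy_point_mixture _ _ _ _

/-- For the `softCopyLast` process, the pointwise conditional entropy
`H(X_{n+1} | X_Λ = xs)` does not depend on the positive-probability values `xs` and
depends on the nonempty index set `Λ ⊆ {1,…,n}` only through its largest element;
in particular, the `softCopyLast` distribution is causally isotropic. -/
theorem softCopyLast_condEnt_depends_only_on_max (N V : ℕ) (hV : 1 ≤ V)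
    (n : ℕ) (hn1 : 1 ≤ n) (hn : n < N)
    (Λ Λ' : Finset (Fin N)) (hne : Λ.Nonempty) (hne' : Λ'.Nonempty)
    (hΛ : ∀ j ∈ Λ, (j : ℕ) < n) (hΛ' : ∀ j ∈ Λ', (j : ℕ) < n)
    (hmax : Λ.max' hne = Λ'.max' hne')
    (xs : {j // j ∈ Λ} → Fin V) (xs' : {j // j ∈ Λ'} → Fin V)
    (hxs : 0 < probOf (softCopyLast N V) (fun ω (j : {j // j ∈ Λ}) => ω j.1) xs)
    (hxs' : 0 < probOf (softCopyLast N V) (fun ω (j : {j // j ∈ Λ'}) => ω j.1) xs') :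
    (shannonEntropy
        (condDist (softCopyLast N V)
          (fun ω (j : {j // j ∈ Λ}) => ω j.1) (fun ω => ω ⟨n, hn⟩) xs)
      = shannonEntropy
        (condDist (softCopyLast N V)
          (fun ω (j : {j // j ∈ Λ'}) => ω j.1) (fun ω => ω ⟨n, hn⟩) xs'))
    ∧ CausallyIsotropic (softCopyLast N V) := by
  refine ⟨shannonEntropy_condDist_softCopyLast hV hn hne hne' hΛ hΛ' hmax hxs hxs', ?_⟩
  intro k hk M hM ys ys' hys hys'
  rcases M.eq_empty_or_nonempty with rfl | hMne
  · rw [show ys = ys' from funext fun j => absurd j.2 (notMem_empty _)]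
  · exact shannonEntropy_condDist_softCopyLast hV hk hMne hMne hM hM rfl hys hys'
end

section
/- Let n ≥ 1, γ ∈ ℝ, and c ∈ ℝ. For 1 ≤ i ≤ n define α_i = (i·e^c) / (i·e^c + ∑_{k=i}^{n−1} e^{−kγ}), where the sum is empty (equal to 0) when i = n. Then 0 < α_1 < α_2 < ⋯ < α_n = 1. (α_i is the total probability that the StableMask softmax assigns to the i real attention scores in row i when all raw attention scores equal the constant c, i.e. for an all-identical input sequence; its strict monotonicity shows StableMask encodes absolute positional information in this case.) -/
open Finset

/-- For `n ≥ 1`, `γ, c ∈ ℝ`, let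
`α_i = (i·e^c) / (i·e^c + ∑_{k=i}^{n−1} e^{−kγ})` (the total real-attention mass of
row `i` of the StableMask softmax when all raw attention scores equal `c`).
Then `0 < α_1 < α_2 < ⋯ < α_n = 1`. -/
theorem stableMask_row_mass_strictMono (n : ℕ) (hn : 1 ≤ n) (γ c : ℝ)
    (α : ℕ → ℝ)
    (hα : ∀ i, α i =
      (i * Real.exp c) /
        (i * Real.exp c + ∑ k ∈ Finset.Ico i n, Real.exp (-(k : ℝ) * γ))) :
    0 < α 1 ∧ (∀ i, 1 ≤ i → i < n → α i < α (i + 1)) ∧ α n = 1 := by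
  have hE : 0 < Real.exp c := Real.exp_pos c
  have hS : ∀ i, 0 ≤ ∑ k ∈ Finset.Ico i n, Real.exp (-(k : ℝ) * γ) :=
    fun i => Finset.sum_nonneg fun k _ => (Real.exp_pos _).le
  refine ⟨?_, fun i hi hin => ?_, ?_⟩
  · rw [hα]
    have := hS 1
    push_cast
    positivity
  · rw [hα, hα, Finset.sum_eq_sum_Ico_succ_bot hin]
    have hT := hS (i + 1)
    have hx : 0 < Real.exp (-(i : ℝ) * γ) := Real.exp_pos _
    have hi' : (0 : ℝ) < i := by exact_mod_cast hi
    generalize ∑ k ∈ Finset.Ico (i + 1) n, Real.exp (-(k : ℝ) * γ) = T at hT ⊢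
    generalize Real.exp (-(i : ℝ) * γ) = x at hx ⊢
    push_cast
    rw [div_lt_div_iff₀ (by positivity) (by positivity), ← sub_pos]
    have key : 0 < Real.exp c * (T + (i + 1) * x) := by positivity
    linarith
  · have hn' : (n : ℝ) ≠ 0 := by exact_mod_cast (by omega : n ≠ 0)
    rw [hα, Finset.Ico_self, Finset.sum_empty, add_zero]
    exact div_self (mul_ne_zero hn' hE.ne')
end

section
/- Let n ≥ 1 and γ ∈ ℝ. Define ξ_i = i/(i + ∑_{k=i}^{n−1} e^{−kγ}) for 1 ≤ i ≤ n, where the sum is empty when i = n. Then ξ is strictly increasing: ξ_1 < ξ_2 < ⋯ < ξ_n = 1, and 0 < ξ_i ≤ 1 for all i. In particular the map i ↦ ξ_i is injective on {1,…,n}, so the absolute position i is uniquely determined by ξ_i. (This is the key lemma in the proof that a Transformer decoder with StableMask can recover absolute positions [1,2,…,n] in its first-layer hidden state.) -/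
open Finset

/-- For `n ≥ 1` and `γ ∈ ℝ`, the quantities
`ξ_i = i/(i + ∑_{k=i}^{n−1} e^{−kγ})` satisfy `ξ_1 < ξ_2 < ⋯ < ξ_n = 1` and
`0 < ξ_i ≤ 1` for `1 ≤ i ≤ n`; in particular `i ↦ ξ_i` is injective on `{1,…,n}`,
so the absolute position `i` is uniquely determined by `ξ_i`. -/
theorem xi_strictMono_injective (n : ℕ) (hn : 1 ≤ n) (γ : ℝ)
    (ξ : ℕ → ℝ)
    (hξ : ∀ i, ξ i =
      (i : ℝ) / ((i : ℝ) + ∑ k ∈ Finset.Ico i n, Real.exp (-(k : ℝ) * γ))) :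
    (∀ i, 1 ≤ i → i < n → ξ i < ξ (i + 1)) ∧
    ξ n = 1 ∧
    (∀ i, 1 ≤ i → i ≤ n → 0 < ξ i ∧ ξ i ≤ 1) ∧
    (∀ i ∈ Finset.Icc 1 n, ∀ j ∈ Finset.Icc 1 n, ξ i = ξ j → i = j) := by
  have hS : ∀ i, 0 ≤ ∑ k ∈ Finset.Ico i n, Real.exp (-(k : ℝ) * γ) := fun i =>
    Finset.sum_nonneg fun k _ => (Real.exp_pos _).le
  have hstep : ∀ i, 1 ≤ i → i < n → ξ i < ξ (i + 1) := by
    intro i hi hin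
    have hi' : (0 : ℝ) < i := by exact_mod_cast hi
    have hE := Real.exp_pos (-(i : ℝ) * γ)
    have hT := hS (i + 1)
    rw [hξ, hξ, Finset.sum_eq_sum_Ico_succ_bot hin]
    push_cast
    rw [div_lt_div_iff₀ (by positivity) (by positivity)]
    nlinarith [mul_pos hi' hE]
  have hlt : ∀ i j, 1 ≤ i → i < j → j ≤ n → ξ i < ξ j := by
    intro i j hi hij
    induction j, hij using Nat.le_induction with
    | base => exact hstep i hi
    | succ j hij ih =>
      intro hj
      exact (ih (by omega)).trans (hstep j (by omega) hj)
  refine ⟨hstep, ?_, ?_, ?_⟩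
  · have hn' : (n : ℝ) ≠ 0 := by exact_mod_cast (by omega : n ≠ 0)
    simp [hξ, hn']
  · intro i hi _
    have hi' : (0 : ℝ) < i := by exact_mod_cast hi
    have hT := hS i
    rw [hξ]
    exact ⟨by positivity, (div_le_one (by positivity)).2 (by linarith)⟩
  · intro i hi j hj hij
    rw [Finset.mem_Icc] at hi hj
    rcases lt_trichotomy i j with h | h | h
    · exact absurd hij (hlt i j hi.1 h hj.2).ne
    · exact h
    · exact absurd hij (hlt j i hj.1 h hi.2).ne'
end

section
/- Let n ≥ 1, d ≥ 1, L ≥ 0. For each layer l ∈ {1,…,L}, let W^{(l)} : ℝ^{n×d} → ℝ^{n×n} be an arbitrary (possibly input-dependent) attention-weight map whose output always has every row summing to 1, and let g_l : ℝ^d × ℝ^d → ℝ^d be an arbitrary function applied identically at every position; define layer l by mapping X ∈ ℝ^{n×d} (rows X_1,…,X_n) to Y with Y_i = g_l(X_i, ∑_{j=1}^{n} W^{(l)}(X)_{ij} X_j). If the input has all n rows equal to a vector x ∈ ℝ^d, then after every layer all n rows remain equal; in particular the output of the L-layer composition has all rows equal to h_L where h_0 = x and h_l = g_l(h_{l−1},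 h_{l−1}). Hence any decoder whose attention weights form right stochastic matrices—such as a decoder-only Transformer with any relative positional encoding, whose causal softmax always yields rows summing to 1—produces identical outputs at all positions on an all-identical input sequence and therefore cannot encode absolute positional information. -/
open Finset

/-- Consider `L` layers, where layer `l` maps `X ∈ ℝ^{n×d}` (rows
`X_1,…,X_n`) to `Y` with `Y_i = g_l(X_i, ∑_j W^{(l)}(X)_{ij} • X_j)`, the
(possibly input-dependent) attention weights `W^{(l)}(X)` always having rows summing
to `1`, and `g_l` applied identically at every position. If the input has all rows
equal to `x`, then after every layer all rows remain equal; the output of the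
`L`-layer composition has all rows equal to `h_L`, where `h_0 = x` and
`h_{l} = g_l(h_{l−1}, h_{l−1})`. Hence a decoder whose attention weights form right
stochastic matrices produces identical outputs at all positions on an all-identical
input and cannot encode absolute positional information. -/
theorem rightStochastic_decoder_identical_rows (n d L : ℕ) (hn : 1 ≤ n) (hd : 1 ≤ d)
    (W : ℕ → (Fin n → Fin d → ℝ) → Fin n → Fin n → ℝ)
    (g : ℕ → (Fin d → ℝ) → (Fin d → ℝ) → Fin d → ℝ)
    (hW : ∀ l, l < L → ∀ (X : Fin n → Fin d → ℝ) (i : Fin n), ∑ j, W l X i j = 1)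
    (x : Fin d → ℝ)
    (states : ℕ → Fin n → Fin d → ℝ)
    (hstates0 : states 0 = fun _ => x)
    (hstatesStep : ∀ l (i : Fin n),
      states (l + 1) i = g l (states l i) (∑ j, W l (states l) i j • states l j))
    (h : ℕ → Fin d → ℝ)
    (hh0 : h 0 = x)
    (hhStep : ∀ l, h (l + 1) = g l (h l) (h l)) :
    ∀ l, l ≤ L → ∀ i : Fin n, states l i = h l := by
  intro l
  induction l with
  | zero =>
    intro _ i
    rw [hstates0, hh0]
  | succ l ih =>
    intro hl i
    have rows_eq := ih (Nat.le_of_succ_le hl)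
    simp only [hstatesStep, hhStep, rows_eq, ← Finset.sum_smul, hW l hl, one_smul]
end
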